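/- arXiv:1602.07208 — 4 statements merged into one kernel-verified Lean document; each statement's English description precedes it below -/
import Mathlib

section
/- Weierstrass's counterexample to the Dirichlet principle: the infimum of the functional J(u) = ∫_{−1}^{1} (x · u'(x))² dx over all continuously differentiable functions u : ℝ → ℝ with u(−1) = −1 and u(1) = 1 is zero, but there is no such function attaining the value 0. -/
open intervalIntegral

noncomputable def weierstrassFunctional (u : ℝ → ℝ) : ℝ :=
  ∫ x in (-1 : ℝ)..1, (x * deriv u x) ^ 2

theorem integral_deriv_eq_two {u : ℝ → ℝ} (hu : ContDiff ℝ 1 u) (hneg : u (-1) = -1)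
    (hpos : u 1 = 1) : ∫ x in (-1 : ℝ)..1, deriv u x = 2 := by
  rw [integral_deriv_eq_sub (fun x _ => hu.differentiable one_ne_zero x)
    (hu.continuous_deriv_one.intervalIntegrable _ _), hneg, hpos]
  norm_num

theorem continuous_mul_deriv_sq {u : ℝ → ℝ} (hu : ContDiff ℝ 1 u) :
    Continuous fun x => (x * deriv u x) ^ 2 :=
  (continuous_id.mul hu.continuous_deriv_one).pow 2

/-- If `(x u'(x))² ≤ c u'(x)` pointwise, then `J(u) ≤ 2c`. -/
theorem weierstrassFunctional_le {u : ℝ → ℝ} (hu : ContDiff ℝ 1 u) (hneg : u (-1) = -1)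
    (hpos : u 1 = 1) {c : ℝ} (hc : ∀ x, (x * deriv u x) ^ 2 ≤ c * deriv u x) :
    weierstrassFunctional u ≤ c * 2 := by
  rw [← integral_deriv_eq_two hu hneg hpos, ← integral_const_mul]
  exact integral_mono (by norm_num) ((continuous_mul_deriv_sq hu).intervalIntegrable _ _)
    ((hu.continuous_deriv_one.const_mul c).intervalIntegrable _ _) hc

theorem deriv_arctan_mul_div (b A x : ℝ) :
    deriv (fun x => Real.arctan (b * x) / A) x = b / ((1 + (b * x) ^ 2) * A) := by
  have h := (((hasDerivAt_id x).const_mul b).arctan.div_const A).deriv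
  simp only [id_eq, mul_one] at h
  rw [h, one_div_mul_eq_div, div_div]

theorem mul_deriv_arctan_sq_le {b A : ℝ} (hb : 0 < b) (hA : 0 < A) (x : ℝ) :
    (x * (b / ((1 + (b * x) ^ 2) * A))) ^ 2 ≤ 1 / (b * A) * (b / ((1 + (b * x) ^ 2) * A)) := by
  have hs : 0 < 1 + (b * x) ^ 2 := by positivity
  have h₁ : (x * (b / ((1 + (b * x) ^ 2) * A))) ^ 2
      = (b * x) ^ 2 / ((1 + (b * x) ^ 2) * A) ^ 2 := by
    field_simp
  have h₂ : 1 / (b * A) * (b / ((1 + (b * x) ^ 2) * A))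
      = (1 + (b * x) ^ 2) / ((1 + (b * x) ^ 2) * A) ^ 2 := by
    field_simp
  rw [h₁, h₂]
  gcongr
  linarith

theorem not_weierstrassFunctional_eq_zero {u : ℝ → ℝ} (hu : ContDiff ℝ 1 u)
    (hneg : u (-1) = -1) (hpos : u 1 = 1) : weierstrassFunctional u ≠ 0 := by
  intro h
  have hae := (integral_eq_zero_iff_of_le_of_nonneg_ae (by norm_num : (-1 : ℝ) ≤ 1)
    (Filter.Eventually.of_forall fun x => sq_nonneg (x * deriv u x))
    ((continuous_mul_deriv_sq hu).intervalIntegrable _ _)).mp h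
  have hzero : ∫ x in (-1 : ℝ)..1, deriv u x = 0 := by
    rw [integral_of_le (by norm_num)]
    apply MeasureTheory.integral_eq_zero_of_ae
    filter_upwards [hae, MeasureTheory.Measure.ae_ne _ (0 : ℝ)] with x hx hx0
    simpa [hx0] using hx
  linarith [integral_deriv_eq_two hu hneg hpos]

theorem weierstrass_counterexample_dirichlet :
    (∀ ε > (0 : ℝ), ∃ u : ℝ → ℝ, ContDiff ℝ 1 u ∧ u (-1) = -1 ∧ u 1 = 1 ∧
      weierstrassFunctional u < ε) ∧
    ¬ ∃ u : ℝ → ℝ, ContDiff ℝ 1 u ∧ u (-1) = -1 ∧ u 1 = 1 ∧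
      weierstrassFunctional u = 0 := by
  refine ⟨fun ε hε => ?_, fun ⟨u, hu, hneg, hpos, h⟩ =>
    not_weierstrassFunctional_eq_zero hu hneg hpos h⟩
  set b := 1 + 4 / ε with hb
  have hb1 : 1 ≤ b := le_add_of_nonneg_right (by positivity)
  have hA : 1 / 2 < Real.arctan b := by
    have := Real.arctan_mono hb1
    rw [Real.arctan_one] at this
    linarith [Real.pi_gt_three]
  have hA0 : 0 < Real.arctan b := by linarith
  have hu : ContDiff ℝ 1 fun x => Real.arctan (b * x) / Real.arctan b :=
    (contDiff_const.mul contDiff_id).arctan.div_const _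
  have hneg : Real.arctan (b * (-1)) / Real.arctan b = -1 := by
    rw [mul_neg_one, Real.arctan_neg, neg_div, div_self hA0.ne']
  have hpos : Real.arctan (b * 1) / Real.arctan b = 1 := by
    rw [mul_one, div_self hA0.ne']
  refine ⟨_, hu, hneg, hpos, (weierstrassFunctional_le hu hneg hpos
    (c := 1 / (b * Real.arctan b)) fun x => ?_).trans_lt ?_⟩
  · rw [deriv_arctan_mul_div]
    exact mul_deriv_arctan_sq_le (by linarith) hA0 x
  · have hbε : b * ε = ε + 4 := by rw [hb]; field_simp
    rw [one_div_mul_eq_div, div_lt_iff₀ (by positivity)]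
    nlinarith
end

section
/- Invariance of dimension: if the Euclidean spaces ℝ^m and ℝ^n are homeomorphic, then m = n. -/
open MeasureTheory Set Filter Topology Metric

/-- Change of variables for a small perturbation of the identity supported in a ball. -/
theorem eventually_integral_perturbation_eq {E : Type*} [NormedAddCommGroup E] [NormedSpace ℝ E]
    [FiniteDimensional ℝ E] [MeasurableSpace E] [BorelSpace E] (μ : Measure E) [μ.IsAddHaarMeasure]
    {g : E → E} (hg : ContDiff ℝ 1 g) {R : ℝ} (hR : ∀ x ∉ closedBall (0 : E) R, g x = 0)
    (φ : E → ℝ) :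
    ∀ᶠ t in 𝓝 (0 : ℝ), ∫ x in closedBall 0 R,
      φ (x + t • g x) * (ContinuousLinearMap.id ℝ E + t • fderiv ℝ g x).det ∂μ =
        ∫ x in closedBall 0 R, φ x ∂μ := by
  have hsupp : HasCompactSupport g := HasCompactSupport.intro (isCompact_closedBall 0 R) hR
  obtain ⟨K, hK⟩ := hg.lipschitzWith_of_hasCompactSupport hsupp one_ne_zero
  have hdet : ∀ᶠ A in 𝓝 (0 : E →L[ℝ] E), 0 < (ContinuousLinearMap.id ℝ E + A).det := by
    have hc : Continuous fun A : E →L[ℝ] E ↦ (ContinuousLinearMap.id ℝ E + A).det :=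
      ContinuousLinearMap.continuous_det.comp (by fun_prop)
    refine hc.continuousAt.eventually (lt_mem_nhds ?_)
    simp [ContinuousLinearMap.det]
  obtain ⟨δ, hδ, hdet⟩ := Metric.eventually_nhds_iff.1 hdet
  have hsmall : ∀ᶠ t in 𝓝 (0 : ℝ), ‖t‖ * K < min δ 1 := by
    have hc : Continuous fun t : ℝ ↦ ‖t‖ * K := by fun_prop
    refine hc.continuousAt.eventually (gt_mem_nhds ?_)
    simp [hδ]
  filter_upwards [hsmall] with t ht
  set F : E → E := fun x ↦ x + t • g x with hF
  have happ : ApproximatesLinearOn F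
      ((ContinuousLinearEquiv.refl ℝ E : E ≃L[ℝ] E) : E →L[ℝ] E) univ (‖t‖₊ * K) := by
    intro x _ y _
    have h1 : F x - F y - (x - y) = t • (g x - g y) := by
      simp only [hF, smul_sub]; abel
    have h2 := hK.dist_le_mul x y
    rw [dist_eq_norm, dist_eq_norm] at h2
    simp only [ContinuousLinearEquiv.coe_refl, ContinuousLinearMap.coe_id', id_eq, h1, norm_smul,
      NNReal.coe_mul, coe_nnnorm, mul_assoc]
    gcongr
  have hconst : Subsingleton E ∨ ‖t‖₊ * K <
      ‖(((ContinuousLinearEquiv.refl ℝ E).symm : E ≃L[ℝ] E) : E →L[ℝ] E)‖₊⁻¹ := by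
    rcases subsingleton_or_nontrivial E with h | h
    · exact Or.inl h
    · right
      have : ‖ContinuousLinearMap.id ℝ E‖₊ = 1 := by
        ext; simp
      simp only [ContinuousLinearEquiv.refl_symm, ContinuousLinearEquiv.coe_refl, this, inv_one]
      rw [← NNReal.coe_lt_coe]
      push_cast
      exact ht.trans_le (min_le_right _ _)
  have hinj : Function.Injective F := injOn_univ.1 (happ.injOn hconst)
  have hsurj : Function.Surjective F := happ.surjective hconst
  have himage : F '' closedBall 0 R = closedBall 0 R := by
    have hcompl : F '' (closedBall 0 R)ᶜ = (closedBall 0 R)ᶜ := by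
      refine (image_congr fun x hx ↦ ?_).trans (image_id _)
      simp [hF, hR x hx]
    rw [image_compl_eq ⟨hinj, hsurj⟩] at hcompl
    exact compl_injective hcompl
  have hderiv : ∀ x, HasFDerivAt F (ContinuousLinearMap.id ℝ E + t • fderiv ℝ g x) x := fun x ↦
    (hasFDerivAt_id x).add (((hg.differentiable one_ne_zero) x).hasFDerivAt.const_smul t)
  have hcov := integral_image_eq_integral_abs_det_fderiv_smul μ measurableSet_closedBall
    (fun x _ ↦ (hderiv x).hasFDerivWithinAt) hinj.injOn φ (s := closedBall 0 R)
  rw [himage] at hcov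
  rw [hcov]
  refine integral_congr_ae (.of_forall fun x ↦ ?_)
  have hpos : 0 < (ContinuousLinearMap.id ℝ E + t • fderiv ℝ g x).det := by
    apply hdet
    rw [dist_zero_right, norm_smul]
    refine lt_of_le_of_lt ?_ (ht.trans_le (min_le_left _ _))
    gcongr
    exact norm_fderiv_le_of_lipschitz ℝ hK
  simp only [abs_of_pos hpos, smul_eq_mul, hF, mul_comm]

/-- The integral of a polynomial against the Jacobian of a compactly supported perturbation of the
identity does not depend on the perturbation. -/
theorem integral_mvPolynomial_perturbation_eq {ι : Type*} [Fintype ι] [DecidableEq ι]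
    {g : (ι → ℝ) → (ι → ℝ)} (hg : ContDiff ℝ 1 g) {R : ℝ}
    (hR : ∀ x ∉ closedBall (0 : ι → ℝ) R, g x = 0) (p : MvPolynomial ι ℝ) :
    ∫ x in closedBall 0 R, MvPolynomial.eval (x + g x) p *
      (ContinuousLinearMap.id ℝ (ι → ℝ) + fderiv ℝ g x).det =
        ∫ x in closedBall 0 R, MvPolynomial.eval x p := by
  let coord (i : ι) : C(ι → ℝ, ℝ) := ⟨fun x ↦ x i, by fun_prop⟩
  let gC (i : ι) : C(ι → ℝ, ℝ) := ⟨fun x ↦ g x i, by have := hg.continuous; fun_prop⟩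
  let gD (i j : ι) : C(ι → ℝ, ℝ) := ⟨fun x ↦ fderiv ℝ g x (Pi.single j 1) i, by
    have := hg.continuous_fderiv one_ne_zero; fun_prop⟩
  let M : Matrix ι ι (Polynomial C(ι → ℝ, ℝ)) :=
    1 + (Polynomial.X : Polynomial C(ι → ℝ, ℝ)) • Matrix.of fun i j ↦ Polynomial.C (gD i j)
  let P : Polynomial C(ι → ℝ, ℝ) :=
    MvPolynomial.aeval (fun i ↦ Polynomial.C (coord i) + Polynomial.X * Polynomial.C (gC i)) p *
      M.det
  let ev (t : ℝ) (x : ι → ℝ) : Polynomial C(ι → ℝ, ℝ) →+* ℝ :=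
    (ContinuousMap.evalAlgHom ℝ ℝ x : C(ι → ℝ, ℝ) →+* ℝ).comp
      (Polynomial.evalRingHom (algebraMap ℝ C(ι → ℝ, ℝ) t))
  have hP (t : ℝ) (x : ι → ℝ) : ev t x P = MvPolynomial.eval (x + t • g x) p *
      (ContinuousLinearMap.id ℝ (ι → ℝ) + t • fderiv ℝ g x).det := by
    have hcoef : (ev t x).comp (algebraMap ℝ (Polynomial C(ι → ℝ, ℝ))) = RingHom.id ℝ :=
      Subsingleton.elim _ _
    have hdet : (ContinuousLinearMap.id ℝ (ι → ℝ) + t • fderiv ℝ g x).det =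
        ((ev t x).mapMatrix M).det := by
      rw [ContinuousLinearMap.det, ← LinearMap.det_toMatrix']
      congr 1
      ext i j
      by_cases hij : i = j <;> simp [M, ev, gD, LinearMap.toMatrix'_apply, hij] <;> ring
    have heval : ev t x (MvPolynomial.aeval
        (fun i ↦ Polynomial.C (coord i) + Polynomial.X * Polynomial.C (gC i)) p) =
        MvPolynomial.eval (x + t • g x) p := by
      rw [MvPolynomial.aeval_def, MvPolynomial.hom_eval₂, hcoef, MvPolynomial.eval,
        MvPolynomial.coe_eval₂Hom]
      congr 1
      ext i
      simp [ev, coord, gC]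
      ring
    rw [hdet, ← RingHom.map_det, ← heval, ← map_mul]
  let Q : Polynomial ℝ := ∑ j ∈ Finset.range (P.natDegree + 1),
    Polynomial.C (∫ x in closedBall 0 R, P.coeff j x) * Polynomial.X ^ j
  have hQ (t : ℝ) : Q.eval t = ∫ x in closedBall 0 R, MvPolynomial.eval (x + t • g x) p *
      (ContinuousLinearMap.id ℝ (ι → ℝ) + t • fderiv ℝ g x).det := by
    simp_rw [← hP]
    have hev (x : ι → ℝ) : ev t x P = ∑ j ∈ Finset.range (P.natDegree + 1), P.coeff j x * t ^ j := by
      simp [ev, Polynomial.eval_eq_sum_range]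
    simp_rw [hev]
    rw [integral_finsetSum]
    · simp [Q, Polynomial.eval_finsetSum, integral_mul_const]
    · intro j _
      refine ContinuousOn.integrableOn_compact (isCompact_closedBall 0 R) ?_
      fun_prop
  have hconst : Q = Polynomial.C (∫ x in closedBall 0 R, MvPolynomial.eval x p) := by
    refine Polynomial.eq_of_infinite_eval_eq _ _ (infinite_of_mem_nhds (0 : ℝ) ?_)
    filter_upwards [eventually_integral_perturbation_eq volume hg hR
      fun x ↦ MvPolynomial.eval x p] with t ht
    simp [hQ, ht]
  have := hQ 1
  simpa [hconst] using this.symm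

/-- A compactly supported `C¹` perturbation of the identity vanishes somewhere. -/
theorem exists_add_eq_zero_of_contDiff {ι : Type*} [Fintype ι]
    {g : (ι → ℝ) → (ι → ℝ)} (hg : ContDiff ℝ 1 g) (hsupp : HasCompactSupport g) :
    ∃ x, x + g x = 0 := by
  classical
  by_contra! hne
  obtain ⟨R, hRpos, hR⟩ : ∃ R > 0, ∀ x ∉ closedBall (0 : ι → ℝ) R, g x = 0 := by
    obtain ⟨R, hRpos, hR⟩ := hsupp.isCompact.isBounded.subset_closedBall_lt 0 0
    exact ⟨R, hRpos, fun x hx ↦ image_eq_zero_of_notMem_tsupport fun h ↦ hx (hR h)⟩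
  set B := closedBall (0 : ι → ℝ) R
  have hB : IsCompact B := isCompact_closedBall 0 R
  have hgc := hg.continuous
  let q (x : ι → ℝ) : ℝ := ∑ i, x i ^ 2
  have hqc : Continuous q := by fun_prop
  have hqpos (x : ι → ℝ) (hx : x ≠ 0) : 0 < q x := by
    obtain ⟨i, hi⟩ := Function.ne_iff.1 hx
    exact Finset.sum_pos' (fun i _ ↦ sq_nonneg _) ⟨i, Finset.mem_univ i, sq_pos_of_ne_zero hi⟩
  have hFc : Continuous fun x ↦ q (x + g x) := by fun_prop
  have hJc : Continuous fun x ↦ (ContinuousLinearMap.id ℝ (ι → ℝ) + fderiv ℝ g x).det :=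
    ContinuousLinearMap.continuous_det.comp
      (continuous_const.add (hg.continuous_fderiv one_ne_zero))
  obtain ⟨r, hr, hrB⟩ : ∃ r > 0, ∀ x ∈ B, r ≤ q (x + g x) := by
    obtain ⟨x₀, -, hx₀⟩ := hB.exists_isMinOn ⟨0, by simp [B, hRpos.le]⟩ hFc.continuousOn
    exact ⟨_, hqpos _ (hne x₀), fun x hx ↦ hx₀ hx⟩
  obtain ⟨C₁, hC₁⟩ := hB.exists_bound_of_continuousOn hFc.continuousOn
  obtain ⟨C₂, hC₂⟩ := hB.exists_bound_of_continuousOn hqc.continuousOn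
  obtain ⟨D, hD⟩ := hB.exists_bound_of_continuousOn hJc.continuousOn
  let C := max (max C₁ C₂) r
  have hCr : r ≤ C := le_max_right _ _
  have hCF (x) (hx : x ∈ B) : q (x + g x) ≤ C :=
    (le_abs_self _).trans ((hC₁ x hx).trans ((le_max_left _ _).trans (le_max_left _ _)))
  have hCq (x) (hx : x ∈ B) : q x ≤ C :=
    (le_abs_self _).trans ((hC₂ x hx).trans ((le_max_right _ _).trans (le_max_left _ _)))
  obtain ⟨ρ, hρ, hρq⟩ : ∃ ρ > 0, ∀ x ∈ closedBall (0 : ι → ℝ) ρ, q x ≤ r / 2 := by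
    have h : ∀ᶠ x in 𝓝 (0 : ι → ℝ), q x ≤ r / 2 := by
      refine hqc.continuousAt.eventually (ge_mem_nhds ?_)
      simp [q, hr]
    exact nhds_basis_closedBall.eventually_iff.1 h
  let b := closedBall (0 : ι → ℝ) (min ρ R)
  have hbB : b ⊆ B := closedBall_subset_closedBall (min_le_right _ _)
  have hbpos : 0 < volume.real b :=
    ENNReal.toReal_pos (measure_closedBall_pos volume _ (lt_min hρ hRpos)).ne'
      measure_closedBall_lt_top.ne
  have key (k : ℕ) : volume.real b * (C - r / 2) ^ k ≤ (D * volume.real B) * (C - r) ^ k := by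
    have h := integral_mvPolynomial_perturbation_eq hg hR
      ((MvPolynomial.C C - ∑ i, MvPolynomial.X i ^ 2) ^ k)
    simp only [map_pow, map_sub, MvPolynomial.eval_C, map_sum, MvPolynomial.eval_X] at h
    change ∫ x in B, (C - q (x + g x)) ^ k * _ = ∫ x in B, (C - q x) ^ k at h
    have hint : IntegrableOn (fun x ↦ (C - q x) ^ k) B :=
      ContinuousOn.integrableOn_compact hB (by fun_prop)
    calc volume.real b * (C - r / 2) ^ k = ∫ x in b, (C - r / 2) ^ k := by simp
      _ ≤ ∫ x in b, (C - q x) ^ k := by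
        refine setIntegral_mono_on (by simp [b, measure_closedBall_lt_top])
          (hint.mono_set hbB) measurableSet_closedBall fun x hx ↦ ?_
        have := hρq x (closedBall_subset_closedBall (min_le_left _ _) hx)
        have : 0 ≤ C - r / 2 := by linarith
        gcongr
      _ ≤ ∫ x in B, (C - q x) ^ k := by
        refine setIntegral_mono_set hint ?_ (.of_forall hbB)
        filter_upwards [ae_restrict_mem measurableSet_closedBall] with x hx
        exact pow_nonneg (sub_nonneg.2 (hCq x hx)) k
      _ ≤ ‖∫ x in B, (C - q (x + g x)) ^ k *
          (ContinuousLinearMap.id ℝ (ι → ℝ) + fderiv ℝ g x).det‖ := by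
        rw [h]; exact le_abs_self _
      _ ≤ ((C - r) ^ k * D) * volume.real B := by
        refine norm_setIntegral_le_of_norm_le_const measure_closedBall_lt_top fun x hx ↦ ?_
        have h1 : 0 ≤ C - q (x + g x) := sub_nonneg.2 (hCF x hx)
        have h2 := hrB x hx
        have h3 : 0 ≤ C - r := by linarith
        rw [norm_mul, norm_pow, Real.norm_of_nonneg h1]
        have := hD x hx
        gcongr
      _ = _ := by ring
  have hCpos : 0 < C - r / 2 := by linarith
  have hlim : Tendsto (fun k : ℕ ↦ (D * volume.real B) * ((C - r) / (C - r / 2)) ^ k) atTop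
      (𝓝 ((D * volume.real B) * 0)) := by
    refine (tendsto_pow_atTop_nhds_zero_of_lt_one ?_ ?_).const_mul _
    · exact div_nonneg (by linarith) hCpos.le
    · rw [div_lt_one hCpos]; linarith
  rw [mul_zero] at hlim
  refine hbpos.not_ge (ge_of_tendsto' hlim fun k ↦ ?_)
  rw [div_pow, ← mul_div_assoc, le_div_iff₀ (by positivity)]
  exact key k

/-- A compactly supported continuous perturbation of the identity vanishes somewhere. -/
theorem exists_add_eq_zero_of_continuous {ι : Type*} [Fintype ι]
    {g : (ι → ℝ) → (ι → ℝ)} (hg : Continuous g) (hsupp : HasCompactSupport g) :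
    ∃ x, x + g x = 0 := by
  by_contra! hne
  have hpos (x) : 0 < ‖x + g x‖ := norm_pos_iff.2 (hne x)
  obtain ⟨g', hg', happ, hsupp'⟩ := hg.exists_contDiff_approx 1
    (ε := fun x ↦ ‖x + g x‖) (by fun_prop) hpos
  obtain ⟨x, hx⟩ := exists_add_eq_zero_of_contDiff (mod_cast hg') (hsupp.mono hsupp')
  have h := happ x
  rw [dist_eq_norm, ← add_sub_add_left_eq_sub _ _ x, hx, zero_sub, norm_neg] at h
  exact lt_irrefl _ h

/-- **Poincaré–Miranda theorem** for a map whose sign conditions hold on the half-spaces bounded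
by the faces of the cube `[-1, 1]^ι`. -/
theorem exists_eq_zero_of_pos_of_neg {ι : Type*} [Fintype ι]
    {f : (ι → ℝ) → (ι → ℝ)} (hf : Continuous f) (hpos : ∀ x i, 1 ≤ x i → 0 < f x i)
    (hneg : ∀ x i, x i ≤ -1 → f x i < 0) : ∃ x, f x = 0 := by
  let s (x : ι → ℝ) : ℝ := max 0 (min 1 (2 - ‖x‖))
  have hs : Continuous s := by fun_prop
  have hs0 (x) : 0 ≤ s x := le_max_left _ _
  have hs1 (x) : s x ≤ 1 := max_le zero_le_one (min_le_left _ _)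
  have hsupp : HasCompactSupport fun x ↦ s x • (f x - x) := by
    refine HasCompactSupport.intro (isCompact_closedBall 0 2) fun x hx ↦ ?_
    rw [mem_closedBall_zero_iff, not_le] at hx
    have : s x = 0 := max_eq_left ((min_le_right _ _).trans (by linarith))
    simp [this]
  obtain ⟨x, hx⟩ := exists_add_eq_zero_of_continuous (by fun_prop) hsupp
  have hcoord (i) : (1 - s x) * x i + s x * f x i = 0 := by
    have := congrFun hx i
    simp only [Pi.add_apply, Pi.smul_apply, Pi.sub_apply, smul_eq_mul, Pi.zero_apply] at this
    linarith
  have hle : ‖x‖ ≤ 1 := by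
    refine (pi_norm_le_iff_of_nonneg zero_le_one).2 fun i ↦ abs_le.2 ⟨?_, ?_⟩ <;> by_contra! hi
    · have h1 := hneg x i hi.le
      rcases (hs0 x).eq_or_lt with h | h
      · have := hcoord i; rw [← h] at this; linarith
      · nlinarith [hcoord i, hs1 x]
    · have h1 := hpos x i hi.le
      rcases (hs0 x).eq_or_lt with h | h
      · have := hcoord i; rw [← h] at this; linarith
      · nlinarith [hcoord i, hs1 x]
  have hsx : s x = 1 := by
    simp only [s]
    rw [min_eq_left (by linarith), max_eq_right zero_le_one]
  refine ⟨x, funext fun i ↦ ?_⟩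
  simpa [hsx] using hcoord i

/-- **Lebesgue covering theorem**, colored form: if for each `k` a locally finite family of disjoint
closed sets is given, none of which meets both `k`-th faces of the cube, then these families together
do not cover the interior of the cube. -/
theorem exists_forall_notMem_of_locallyFinite {ι : Type*} [Fintype ι] {κ : ι → Type*}
    (W : ∀ k, κ k → Set (ι → ℝ)) (hclosed : ∀ k c, IsClosed (W k c))
    (hfin : ∀ k, LocallyFinite (W k)) (hdisj : ∀ k, Pairwise (Function.onFun Disjoint (W k)))
    (hface : ∀ k c, ∀ x ∈ W k c, ∀ y ∈ W k c, x k ≤ -1 → ¬ 1 ≤ y k) :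
    ∃ x ∈ ball (0 : ι → ℝ) 1, ∀ k c, x ∉ W k c := by
  have hsep (k : ι) : ∃ f : (ι → ℝ) → ℝ, Continuous f ∧ (∀ x, 1 ≤ x k → 0 < f x) ∧
      (∀ x, x k ≤ -1 → f x < 0) ∧ ∀ c, ∀ x ∈ W k c, f x ≠ 0 := by
    let S : Set (κ k) := {c | ∃ y ∈ W k c, y k ≤ -1}
    let P : Set (ι → ℝ) := {x | x k ≤ -1} ∪ ⋃ c : S, W k c
    let Q : Set (ι → ℝ) := {x | 1 ≤ x k} ∪ ⋃ c : (Sᶜ : Set (κ k)), W k c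
    have hP : IsClosed P := (isClosed_le (by fun_prop) (by fun_prop)).union
      (((hfin k).comp_injective Subtype.val_injective).isClosed_iUnion fun c ↦ hclosed k c)
    have hQ : IsClosed Q := (isClosed_le (by fun_prop) (by fun_prop)).union
      (((hfin k).comp_injective Subtype.val_injective).isClosed_iUnion fun c ↦ hclosed k c)
    have hPQ : Disjoint P Q := by
      rw [Set.disjoint_left]
      rintro x (hxP | hxP) (hxQ | hxQ)
      · simp only [mem_ofPred_eq] at hxP hxQ
        linarith
      · obtain ⟨⟨c, hc⟩, hxc⟩ := mem_iUnion.1 hxQ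
        exact hc ⟨x, hxc, hxP⟩
      · obtain ⟨⟨c, y, hy, hyk⟩, hxc⟩ := mem_iUnion.1 hxP
        exact hface k c y hy x hxc hyk hxQ
      · obtain ⟨⟨c, hc⟩, hxc⟩ := mem_iUnion.1 hxP
        obtain ⟨⟨d, hd⟩, hxd⟩ := mem_iUnion.1 hxQ
        have hcd : c ≠ d := fun h ↦ hd (h ▸ hc)
        exact Set.disjoint_left.1 (hdisj k hcd) hxc hxd
    obtain ⟨f, hfP, hfQ, -⟩ := exists_continuous_zero_one_of_isClosed hP hQ hPQ
    refine ⟨fun x ↦ 2 * f x - 1, by fun_prop, fun x hx ↦ ?_, fun x hx ↦ ?_, fun c x hx ↦ ?_⟩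
    · norm_num [hfQ (Or.inl hx : x ∈ Q)]
    · norm_num [hfP (Or.inl hx : x ∈ P)]
    · by_cases hc : c ∈ S
      · norm_num [hfP (Or.inr (mem_iUnion.2 ⟨⟨c, hc⟩, hx⟩) : x ∈ P)]
      · norm_num [hfQ (Or.inr (mem_iUnion.2 ⟨⟨c, hc⟩, hx⟩) : x ∈ Q)]
  choose f hfc hfpos hfneg hfW using hsep
  obtain ⟨x, hx⟩ := exists_eq_zero_of_pos_of_neg (f := fun x k ↦ f k x) (continuous_pi hfc)
    (fun x k ↦ hfpos k x) (fun x k ↦ hfneg k x)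
  have hx0 (k) : f k x = 0 := congrFun hx k
  refine ⟨x, ?_, fun k c hc ↦ hfW k c x hc (hx0 k)⟩
  rw [mem_ball_zero_iff, pi_norm_lt_iff zero_lt_one]
  refine fun k ↦ abs_lt.2 ⟨?_, ?_⟩ <;> by_contra! hk
  · exact (hfneg k x hk).ne (hx0 k)
  · exact (hfpos k x hk).ne' (hx0 k)

/-- The `c`-th cube of color `k` in the decomposition of `Fin n → ℝ` into `m` families of separated
cubes of side `m - 1`. -/
def coloredCube (m n : ℕ) (k : Fin m) (c : Fin n → ℤ) : Set (Fin n → ℝ) :=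
  {y | ∀ i, c i * m + 1 / 2 ≤ y i - k ∧ y i - k ≤ (c i + 1) * m - 1 / 2}

theorem isClosed_coloredCube (m n : ℕ) (k : Fin m) (c : Fin n → ℤ) :
    IsClosed (coloredCube m n k c) := by
  simp only [coloredCube, ofPred_forall, ofPred_and]
  exact isClosed_iInter fun i ↦ (isClosed_le (by fun_prop) (by fun_prop)).inter
    (isClosed_le (by fun_prop) (by fun_prop))

theorem pairwise_disjoint_coloredCube (m n : ℕ) (k : Fin m) :
    Pairwise (Function.onFun Disjoint (coloredCube m n k)) := by
  refine fun c d hcd ↦ Set.disjoint_left.2 fun y hc hd ↦ hcd (funext fun i ↦ ?_)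
  have hm : (0 : ℝ) < m := by exact_mod_cast k.pos
  have h1 := hc i
  have h2 := hd i
  refine le_antisymm (Int.lt_add_one_iff.1 ?_) (Int.lt_add_one_iff.1 ?_) <;>
    rify <;> refine lt_of_mul_lt_mul_right ?_ hm.le <;> linarith

theorem dist_lt_of_mem_coloredCube {m n : ℕ} {k : Fin m} {c : Fin n → ℤ} {x y : Fin n → ℝ}
    (hx : x ∈ coloredCube m n k c) (hy : y ∈ coloredCube m n k c) : dist x y < m := by
  have hm : (0 : ℝ) < m := by exact_mod_cast k.pos
  refine (dist_pi_lt_iff hm).2 fun i ↦ abs_lt.2 ?_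
  have h1 := hx i
  have h2 := hy i
  constructor <;> linarith

theorem locallyFinite_coloredCube (m n : ℕ) (k : Fin m) : LocallyFinite (coloredCube m n k) := by
  have hm : (0 : ℝ) < m := by exact_mod_cast k.pos
  intro y
  refine ⟨ball y m, ball_mem_nhds y hm, (Set.finite_Icc (fun i ↦ ⌊(y i - k) / m⌋ - 2)
    (fun i ↦ ⌊(y i - k) / m⌋ + 2)).subset ?_⟩
  rintro c ⟨z, hzc, hzy⟩
  have hi (i) : (y i - k) / m < c i + 2 ∧ c i - 2 < (y i - k) / m := by
    have h1 := hzc i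
    have h2 := abs_lt.1 ((dist_pi_lt_iff hm).1 hzy i)
    rw [lt_div_iff₀ hm, div_lt_iff₀ hm]
    constructor <;> linarith
  refine ⟨fun i ↦ sub_le_iff_le_add.2 (Int.floor_lt.2 ?_).le,
    fun i ↦ sub_le_iff_le_add.1 (Int.le_floor.2 ?_)⟩
  · exact_mod_cast (hi i).1
  · exact_mod_cast (hi i).2.le

/-- If there are more colors than dimensions, the colored cubes cover the space. -/
theorem exists_mem_coloredCube {m n : ℕ} (hnm : n < m) (y : Fin n → ℝ) :
    ∃ k c, y ∈ coloredCube m n k c := by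
  have hm : (0 : ℤ) < m := by omega
  let r (i : Fin n) : Fin m := ⟨(round (y i) % m).toNat, by
    have := Int.emod_lt_of_pos (round (y i)) hm
    omega⟩
  obtain ⟨k, hk⟩ : ∃ k, ∀ i, r i ≠ k := by
    by_contra! h
    have := Fintype.card_le_of_surjective r h
    simp only [Fintype.card_fin] at this
    omega
  refine ⟨k, fun i ↦ (round (y i) - k) / m, fun i ↦ ?_⟩
  have hround := abs_le.1 (abs_sub_round (y i))
  have hmod : (round (y i) - k) % m ≠ 0 := by
    intro h
    apply hk i
    have h1 : round (y i) % m = (k : ℤ) % m := Int.emod_eq_emod_iff_emod_sub_eq_zero.2 h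
    have h2 : (k : ℤ) % m = k := Int.emod_eq_of_lt (by positivity) (by exact_mod_cast k.2)
    ext
    simp [r, h1, h2]
  have hdiv := Int.mul_ediv_add_emod (round (y i) - k) m
  have h1 : (1 : ℤ) ≤ (round (y i) - k) % m := by
    have := Int.emod_nonneg (round (y i) - k) hm.ne'
    omega
  have h2 : (round (y i) - k) % m + 1 ≤ m := Int.emod_lt_of_pos _ hm
  beta_reduce
  generalize (round (y i) - k) % m = ρ at *
  generalize (round (y i) - k) / m = a at *
  rify at hdiv h1 h2
  constructor <;> linarith

/-- A homeomorphism cannot decrease the dimension of Euclidean space. -/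
theorem le_of_homeomorph (m n : ℕ) (e : (Fin m → ℝ) ≃ₜ (Fin n → ℝ)) : m ≤ n := by
  by_contra! hnm
  have hm : (0 : ℝ) < m := by exact_mod_cast (Nat.zero_le n).trans_lt hnm
  let K := closedBall (0 : Fin m → ℝ) 1
  have hK : IsCompact K := isCompact_closedBall 0 1
  obtain ⟨ε, hε, hdist⟩ : ∃ ε > 0, ∀ x ∈ K, ∀ y ∈ K, dist (e x) (e y) < ε → dist x y < 2 := by
    have h := (hK.image e.continuous).uniformContinuousOn_of_continuous
      e.symm.continuous.continuousOn
    obtain ⟨ε, hε, h⟩ := Metric.uniformContinuousOn_iff.1 h 2 two_pos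
    refine ⟨ε, hε, fun x hx y hy hxy ↦ ?_⟩
    simpa using h _ (mem_image_of_mem e hx) _ (mem_image_of_mem e hy) hxy
  let u (x : Fin m → ℝ) : Fin n → ℝ := (m / ε) • e x
  have hu : Continuous u := by have := e.continuous; fun_prop
  obtain ⟨x, hx, hxW⟩ := exists_forall_notMem_of_locallyFinite
    (fun k c ↦ K ∩ u ⁻¹' coloredCube m n k c)
    (fun k c ↦ hK.isClosed.inter ((isClosed_coloredCube m n k c).preimage hu))
    (fun k ↦ ((locallyFinite_coloredCube m n k).preimage_continuous hu).subset
      fun c ↦ inter_subset_right)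
    (fun k c d hcd ↦ ((pairwise_disjoint_coloredCube m n k hcd).preimage u).mono
      inter_subset_right inter_subset_right)
    (by
      rintro k c x ⟨hxK, hx⟩ y ⟨hyK, hy⟩ hxk hyk
      have h1 := dist_lt_of_mem_coloredCube hx hy
      have h2 : dist (e x) (e y) < ε := by
        rw [dist_smul₀, Real.norm_of_nonneg (by positivity), div_mul_eq_mul_div,
          div_lt_iff₀ hε] at h1
        exact lt_of_mul_lt_mul_left h1 hm.le
      have h3 := (dist_le_pi_dist x y k).trans_lt (hdist x hxK y hyK h2)
      rw [Real.dist_eq, abs_lt] at h3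
      linarith)
  obtain ⟨k, c, hc⟩ := exists_mem_coloredCube hnm (u x)
  exact hxW k c ⟨ball_subset_closedBall hx, hc⟩

theorem invariance_of_dimension (m n : ℕ)
    (e : (Fin m → ℝ) ≃ₜ (Fin n → ℝ)) : m = n := by
  exact le_antisymm (le_of_homeomorph m n e) (le_of_homeomorph n m e.symm)
end

section
/- Brouwer's invariance of domain: if U is an open subset of ℝⁿ and f : U → ℝⁿ is continuous and injective, then f(U) is open in ℝⁿ and f is an open map onto its image (hence a homeomorphism onto f(U)). -/
open MeasureTheory Metric Set Filter Topology

theorem ContinuousLinearMap.det_one_add_smul_eq_sum_lagrangeBasis {E : Type*} [NormedAddCommGroup E]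
    [NormedSpace ℝ E] [FiniteDimensional ℝ E] (s : Finset ℝ) (hs : Module.finrank ℝ E < s.card)
    (A : E →L[ℝ] E) (t : ℝ) :
    (1 + t • A).det = ∑ i ∈ s, (Lagrange.basis s id i).eval t * (1 + i • A).det := by
  let b := Module.finBasis ℝ E
  let M := LinearMap.toMatrix b b (A : E →ₗ[ℝ] E)
  let p : Polynomial ℝ := Matrix.det ((Polynomial.X : Polynomial ℝ) • M.map Polynomial.C +
    (1 : Matrix _ _ ℝ).map Polynomial.C)
  have hp (u : ℝ) : p.eval u = (1 + u • A).det := by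
    rw [ContinuousLinearMap.det, ← LinearMap.det_toMatrix b, ← Polynomial.coe_evalRingHom,
      RingHom.map_det]
    congr 1
    ext i j
    simp only [M, Polynomial.coe_evalRingHom, RingHom.mapMatrix_apply, Matrix.map_apply,
      Matrix.add_apply, Matrix.smul_apply, smul_eq_mul, Polynomial.eval_mul,
      Polynomial.eval_X, Polynomial.eval_C, ContinuousLinearMap.toLinearMap_add, map_add,
      ContinuousLinearMap.toLinearMap_smul, map_smul, ContinuousLinearMap.toLinearMap_one,
      LinearMap.toMatrix_one, add_comm]
  have hdeg : p.degree < s.card := by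
    refine Polynomial.degree_le_natDegree.trans_lt ?_
    have := Polynomial.natDegree_det_X_add_C_le M 1
    rw [Fintype.card_fin] at this
    exact_mod_cast this.trans_lt hs
  rw [← hp, Lagrange.eq_interpolate (v := id) (injOn_id _) hdeg, Lagrange.interpolate_apply,
    Polynomial.eval_finsetSum]
  refine Finset.sum_congr rfl fun i _ ↦ ?_
  rw [Polynomial.eval_mul, Polynomial.eval_C, id, hp, mul_comm]

theorem eventually_forall_det_one_add_smul_pos {E : Type*} [NormedAddCommGroup E]
    [NormedSpace ℝ E] {K : Set E} (hK : IsCompact K)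
    {A : E → E →L[ℝ] E} (hA : Continuous A) :
    ∀ᶠ t : ℝ in 𝓝 0, ∀ x ∈ K, 0 < (1 + t • A x).det := by
  refine hK.eventually_forall_of_forall_eventually fun x _ ↦ ?_
  have hc : Continuous fun p : ℝ × E ↦ (1 + p.1 • A p.2).det :=
    ContinuousLinearMap.continuous_det.comp (by fun_prop)
  refine hc.continuousAt.eventually (lt_mem_nhds ?_)
  simp [ContinuousLinearMap.det]

section

variable {E : Type*} [NormedAddCommGroup E] [InnerProductSpace ℝ E] [FiniteDimensional ℝ E]

theorem det_fderiv_eq_zero_of_norm_eq_one {r : E → E} (hr : Differentiable ℝ r)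
    (hnorm : ∀ x, ‖r x‖ = 1) (x : E) : (fderiv ℝ r x).det = 0 := by
  by_contra hdet
  obtain ⟨v, hv⟩ := ((fderiv ℝ r x).toContinuousLinearEquivOfDetNeZero hdet).surjective (r x)
  rw [ContinuousLinearMap.toContinuousLinearEquivOfDetNeZero_apply] at hv
  have h1 : HasFDerivAt (fun y ↦ ‖r y‖ ^ 2) _ x := (hr x).hasFDerivAt.norm_sq
  have h2 : HasFDerivAt (fun y ↦ ‖r y‖ ^ 2) (0 : E →L[ℝ] ℝ) x := by
    simpa [hnorm] using hasFDerivAt_const (1 : ℝ) x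
  have := DFunLike.congr_fun (h1.unique h2) v
  simp [hv, hnorm] at this

/-- There is no `C¹` retraction onto the unit sphere. -/
theorem not_contDiff_retraction_sphere {r : E → E} (hr : ContDiff ℝ 1 r)
    (hnorm : ∀ x, ‖r x‖ = 1) (hfix : ∀ x ∈ sphere (0 : E) 1, r x = x) : False := by
  borelize E
  let μ : Measure E := Measure.addHaar
  let g : E → E := fun x ↦ r x - x
  have hg : ContDiff ℝ 1 g := hr.sub contDiff_id
  have hgd : Differentiable ℝ g := hg.differentiable one_ne_zero
  have hA : Continuous (fderiv ℝ g) := hg.continuous_fderiv one_ne_zero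
  let B := closedBall (0 : E) 1
  have hB : IsCompact B := isCompact_closedBall 0 1
  obtain ⟨K, hK⟩ : ∃ K, LipschitzOnWith K g B := by
    obtain ⟨C, hC⟩ := hB.exists_bound_of_continuousOn hA.continuousOn
    exact ⟨C.toNNReal, (convex_closedBall 0 1).lipschitzOnWith_of_nnnorm_fderiv_le
      (fun x _ ↦ hgd x) fun x hx ↦ by
        rw [← NNReal.coe_le_coe]; exact (hC x hx).trans (Real.le_coe_toNNReal C)⟩
  have hev : ∀ᶠ t : ℝ in 𝓝 0, t < 1 ∧ |t| * K < 1 ∧ ∀ x ∈ B, 0 < (1 + t • fderiv ℝ g x).det := by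
    refine (gt_mem_nhds one_pos).and (.and ?_ (eventually_forall_det_one_add_smul_pos hB hA))
    have : Continuous fun t : ℝ ↦ |t| * K := by fun_prop
    exact this.continuousAt.eventually (gt_mem_nhds (by simp))
  obtain ⟨t₀, ht₀, ht⟩ : ∃ t₀ > 0, ∀ t ∈ Ioo (0 : ℝ) t₀, t < 1 ∧ |t| * K < 1 ∧
      ∀ x ∈ B, 0 < (1 + t • fderiv ℝ g x).det := by
    obtain ⟨ε, hε, h⟩ := Metric.eventually_nhds_iff.1 hev
    exact ⟨ε, hε, fun t ht ↦ h (by simpa [abs_of_pos ht.1] using ht.2)⟩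
  have hvol (t : ℝ) (htt : t ∈ Ioo 0 t₀) : ∫ x in B, (1 + t • fderiv ℝ g x).det ∂μ = μ.real B := by
    obtain ⟨ht1, htK, hdet⟩ := ht t htt
    let F : E → E := fun x ↦ x + t • g x
    have hF : ContDiff ℝ 1 F := contDiff_id.add (hg.const_smul t)
    have hF' (x : E) : HasFDerivAt F (1 + t • fderiv ℝ g x) x :=
      (hasFDerivAt_id x).add ((hgd x).hasFDerivAt.const_smul t)
    have hFs (x : E) (hx : ‖x‖ = 1) : F x = x := by
      simp [F, g, hfix x (by simpa using hx)]
    have hinj : InjOn F B := by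
      intro x hx y hy hxy
      have h1 : x - y = t • (g y - g x) := by
        simp only [F] at hxy
        rw [smul_sub, sub_eq_sub_iff_add_eq_add, hxy, add_comm]
      have h2 : ‖x - y‖ ≤ |t| * K * ‖x - y‖ := by
        conv_lhs => rw [h1, norm_smul, Real.norm_eq_abs]
        have := hK.norm_sub_le hy hx
        rw [norm_sub_rev x y, mul_assoc]
        gcongr
      have : ‖x - y‖ = 0 := by nlinarith [norm_nonneg (x - y)]
      exact sub_eq_zero.1 (norm_eq_zero.1 this)
    have hopen : IsOpen (F '' ball 0 1) := by
      rw [isOpen_iff_mem_nhds]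
      rintro _ ⟨x, hx, rfl⟩
      have hdx := (hdet x (ball_subset_closedBall hx)).ne'
      have hs : HasStrictFDerivAt F
          ((ContinuousLinearMap.toContinuousLinearEquivOfDetNeZero _ hdx : E ≃L[ℝ] E) : E →L[ℝ] E)
          x := by
        rw [ContinuousLinearMap.coe_toContinuousLinearEquivOfDetNeZero]
        exact hF.contDiffAt.hasStrictFDerivAt' (hF' x) one_ne_zero
      rw [← hs.map_nhds_eq_of_equiv]
      exact image_mem_map (isOpen_ball.mem_nhds hx)
    have hmem {x : E} (hx : x ∈ B) : F x ∈ B := by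
      have : F x = (1 - t) • x + t • r x := by simp only [F, g]; module
      rw [this]
      exact convex_closedBall 0 1 hx (by simp [hnorm]) (by linarith) htt.1.le (by ring)
    have himage : F '' B = B := by
      refine Subset.antisymm (image_subset_iff.2 fun x hx ↦ hmem hx) fun y hy ↦ ?_
      by_cases hy1 : ‖y‖ = 1
      · exact ⟨y, hy, hFs y hy1⟩
      have hsub : ball (0 : E) 1 ⊆ F '' ball 0 1 := by
        refine (convex_ball 0 1).isPreconnected.subset_of_closure_inter_subset hopen
          ⟨F 0, ?_, mem_image_of_mem F (mem_ball_self one_pos)⟩ ?_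
        · simp [F, g, norm_smul, hnorm, abs_of_pos htt.1, ht1]
        · rintro z ⟨hz, hz1⟩
          have hcl : closure (F '' ball 0 1) ⊆ F '' B :=
            closure_minimal (image_mono ball_subset_closedBall)
              (hB.image hF.continuous).isClosed
          obtain ⟨x, hx, rfl⟩ := hcl hz
          refine ⟨x, ?_, rfl⟩
          have hx' : ‖x‖ ≤ 1 := by simpa [B] using hx
          rw [mem_ball_zero_iff] at hz1 ⊢
          refine hx'.lt_of_ne fun h ↦ ?_
          rw [hFs x h] at hz1
          exact hz1.ne h
      refine image_mono ball_subset_closedBall (hsub ?_)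
      have : ‖y‖ ≤ 1 := by simpa [B] using hy
      simpa using this.lt_of_ne hy1
    have hcv := integral_image_eq_integral_abs_det_fderiv_smul μ isClosed_closedBall.measurableSet
      (fun x _ ↦ (hF' x).hasFDerivWithinAt) hinj (fun _ ↦ (1 : ℝ))
    rw [himage] at hcv
    simp only [smul_eq_mul, mul_one, integral_const, measureReal_restrict_apply_univ] at hcv
    rw [hcv]
    exact setIntegral_congr_fun isClosed_closedBall.measurableSet fun x hx ↦
      (abs_of_pos (hdet x hx)).symm
  obtain ⟨s, hs, hcard⟩ := (Ioo_infinite ht₀).exists_subset_card_eq (Module.finrank ℝ E + 1)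
  have hne : s.Nonempty := Finset.card_pos.1 (by omega)
  have hint (t : ℝ) : IntegrableOn (fun x ↦ (1 + t • fderiv ℝ g x).det) B μ :=
    (ContinuousLinearMap.continuous_det.comp (by fun_prop)).continuousOn.integrableOn_compact hB
  have hone : ∫ x in B, (1 + (1 : ℝ) • fderiv ℝ g x).det ∂μ = μ.real B := by
    have hcard' : Module.finrank ℝ E < s.card := by omega
    simp_rw [fun x ↦ ContinuousLinearMap.det_one_add_smul_eq_sum_lagrangeBasis s hcard'
      (fderiv ℝ g x) 1]
    rw [integral_finsetSum _ fun i _ ↦ (hint i).const_mul _]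
    simp_rw [integral_const_mul]
    rw [Finset.sum_congr rfl fun i hi ↦ by rw [hvol i (hs hi)], ← Finset.sum_mul,
      ← Polynomial.eval_finsetSum, Lagrange.sum_basis (injOn_id _) hne, Polynomial.eval_one, one_mul]
  have hzero (x : E) : (1 + (1 : ℝ) • fderiv ℝ g x).det = 0 := by
    have hrd : Differentiable ℝ r := hr.differentiable one_ne_zero
    rw [← det_fderiv_eq_zero_of_norm_eq_one hrd hnorm x, one_smul,
      show fderiv ℝ g x = fderiv ℝ r x - 1 from
        ((hrd x).hasFDerivAt.sub (hasFDerivAt_id x)).fderiv, add_sub_cancel]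
  simp_rw [hzero, integral_zero] at hone
  exact (ENNReal.toReal_pos (measure_closedBall_pos μ 0 one_pos).ne'
    hB.measure_lt_top.ne).ne hone

theorem Continuous.exists_contDiff_norm_sub_lt {G : E → E} (hG : Continuous G) {ε : ℝ}
    (hε : 0 < ε) : ∃ P : E → E, ContDiff ℝ 1 P ∧ ∀ x, ‖P x - G x‖ < ε := by
  obtain ⟨P, hP, h, -⟩ := hG.exists_contDiff_approx 1 continuous_const (fun _ ↦ hε)
  exact ⟨P, by exact_mod_cast hP, fun x ↦ by simpa [dist_eq_norm] using h x⟩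

theorem IsCompact.exists_pos_forall_le_norm {X F : Type*} [TopologicalSpace X]
    [NormedAddCommGroup F] {K : Set X} (hK : IsCompact K) {G : X → F} (hG : ContinuousOn G K)
    (h0 : ∀ x ∈ K, G x ≠ 0) : ∃ δ > 0, ∀ x ∈ K, δ ≤ ‖G x‖ := by
  rcases K.eq_empty_or_nonempty with rfl | hne
  · exact ⟨1, one_pos, by simp⟩
  obtain ⟨x, hx, hmin⟩ := hK.exists_isMinOn hne hG.norm
  exact ⟨‖G x‖, norm_pos_iff.2 (h0 x hx), hmin⟩

/-- A continuous self-map of the closed unit ball that is close to the identity has a zero. -/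
theorem exists_eq_zero_of_norm_sub_le_half {G : E → E} (hG : ContinuousOn G (closedBall 0 1))
    (hnear : ∀ x ∈ closedBall (0 : E) 1, ‖G x - x‖ ≤ 1 / 2) :
    ∃ x ∈ closedBall (0 : E) 1, G x = 0 := by
  by_contra! h0
  obtain ⟨δ, hδ, hGδ⟩ := (isCompact_closedBall (0 : E) 1).exists_pos_forall_le_norm hG h0
  have : TietzeExtension E := .of_tvs ℝ
  obtain ⟨G', hG'⟩ := ContinuousMap.exists_restrict_eq (isClosed_closedBall (x := (0 : E)) (ε := 1))
    ⟨_, hG.domRestrict⟩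
  have hGG' (x : E) (hx : x ∈ closedBall (0 : E) 1) : G' x = G x :=
    DFunLike.congr_fun hG' ⟨x, hx⟩
  obtain ⟨P, hP, hPG⟩ := G'.continuous.exists_contDiff_norm_sub_lt
    (lt_min hδ (by norm_num : (0 : ℝ) < 1 / 4))
  let χ : ContDiffBump (0 : E) := ⟨4 / 5, 9 / 10, by norm_num, by norm_num⟩
  let H : E → E := fun x ↦ x + χ x • (P x - x)
  have hH : ContDiff ℝ 1 H := contDiff_id.add (χ.contDiff.smul (hP.sub contDiff_id))
  have hHout (x : E) (hx : 1 ≤ ‖x‖) : H x = x := by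
    have : χ x = 0 := χ.zero_of_le_dist (by rw [dist_zero_right]; change 9 / 10 ≤ _; linarith)
    simp [H, this]
  have hH0 (x : E) : H x ≠ 0 := by
    intro hx0
    rcases le_total 1 ‖x‖ with hx | hx
    · rw [hHout x hx] at hx0
      simp [hx0] at hx
      linarith
    have hxB : x ∈ closedBall (0 : E) 1 := by simpa
    have hPx := hPG x
    rw [hGG' x hxB, lt_min_iff] at hPx
    rcases le_or_gt ‖x‖ (4 / 5) with hx' | hx'
    · have : χ x = 1 := χ.one_of_mem_closedBall (by simpa [χ] using hx')
      have hP0 : P x = 0 := by simpa [H, this] using hx0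
      rw [hP0, zero_sub, norm_neg] at hPx
      linarith [hGδ x hxB]
    · have h1 : ‖P x - x‖ ≤ 3 / 4 := by
        linarith [norm_sub_le_norm_sub_add_norm_sub (P x) (G x) x, hnear x hxB, hPx.2]
      have h2 : ‖x‖ = χ x * ‖P x - x‖ := by
        rw [eq_neg_of_add_eq_zero_left hx0, norm_neg, norm_smul, Real.norm_of_nonneg χ.nonneg,
          ← eq_neg_of_add_eq_zero_left hx0]
      nlinarith [χ.le_one (x := x), χ.nonneg (x := x), norm_nonneg (P x - x)]
  refine not_contDiff_retraction_sphere (r := fun x ↦ ‖H x‖⁻¹ • H x)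
    (((hH.norm ℝ hH0).inv fun x ↦ norm_ne_zero_iff.2 (hH0 x)).smul hH) (fun x ↦ ?_) fun x hx ↦ ?_
  · rw [norm_smul, norm_inv, norm_norm, inv_mul_cancel₀ (norm_ne_zero_iff.2 (hH0 x))]
  · have hx1 : ‖x‖ = 1 := by simpa using hx
    simp [hHout x hx1.ge, hx1]

theorem image_closedBall_mem_nhds_of_injOn {f : E → E} (hf : ContinuousOn f (closedBall 0 1))
    (hinj : InjOn f (closedBall 0 1)) : f '' closedBall 0 1 ∈ 𝓝 (f 0) := by
  borelize E
  by_contra hnhds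
  let B := closedBall (0 : E) 1
  have hB : IsCompact B := isCompact_closedBall 0 1
  have : CompactSpace B := isCompact_iff_compactSpace.1 hB
  have : TietzeExtension E := .of_tvs ℝ
  have hemb : IsClosedEmbedding (B.domRestrict f) :=
    hf.domRestrict.isClosedEmbedding hinj.injective
  obtain ⟨G, hG⟩ := ContinuousMap.exists_extension' hemb ⟨Subtype.val, continuous_subtype_val⟩
  have hGf (x : E) (hx : x ∈ B) : G (f x) = x := congr_fun hG ⟨x, hx⟩
  have h0B : (0 : E) ∈ B := mem_closedBall_self zero_le_one
  obtain ⟨ε, hε, hGε⟩ : ∃ ε > 0, ∀ y, dist y (f 0) < 3 * ε → ‖G y‖ < 1 / 10 := by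
    have : Tendsto (fun y ↦ ‖G y‖) (𝓝 (f 0)) (𝓝 0) := by
      simpa [hGf 0 h0B] using (G.continuous.norm.tendsto (f 0))
    obtain ⟨η, hη, h⟩ := Metric.eventually_nhds_iff.1
      (this.eventually (gt_mem_nhds (by norm_num : (0 : ℝ) < 1 / 10)))
    exact ⟨η / 3, by positivity, fun y hy ↦ h (by linarith)⟩
  obtain ⟨c, hcε, hc⟩ : ∃ c ∈ ball (f 0) ε, c ∉ f '' B := by
    by_contra! h
    exact hnhds (mem_of_superset (ball_mem_nhds _ hε) h)
  let S := f '' B \ ball c ε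
  have hS : IsCompact S := (hB.image_of_continuousOn hf).diff isOpen_ball
  have hGS : ∀ y ∈ S, G y ≠ 0 := by
    rintro _ ⟨⟨x, hx, rfl⟩, hxc⟩ h0
    rw [hGf x hx] at h0
    subst h0
    exact hxc (mem_ball_comm.1 hcε)
  obtain ⟨δ, hδ, hGδ⟩ := hS.exists_pos_forall_le_norm G.continuous.continuousOn hGS
  let δ' := min (δ / 2) (1 / 10)
  have hδ' : 0 < δ' := lt_min (by positivity) (by norm_num)
  obtain ⟨P, hP, hPG⟩ := G.continuous.exists_contDiff_norm_sub_lt hδ'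
  obtain ⟨v, hvδ, hvP⟩ : ∃ v ∈ ball (0 : E) δ', v ∉ P '' sphere c ε := by
    by_contra! h
    have hnull : Measure.addHaar (P '' sphere c ε) = 0 :=
      addHaar_image_eq_zero_of_differentiableOn_of_addHaar_eq_zero _
        (hP.differentiable one_ne_zero).differentiableOn
        (Measure.addHaar_sphere_of_ne_zero _ c hε.ne')
    exact (measure_ball_pos Measure.addHaar (0 : E) hδ').ne' (measure_mono_null h hnull)
  rw [mem_ball_zero_iff] at hvδ
  have hQG (y : E) : ‖(P y - v) - G y‖ < 2 * δ' := by
    rw [sub_right_comm]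
    linarith [norm_sub_le (P y - G y) v, hPG y]
  let Φ : E → E := fun y ↦ c + max (ε / ‖y - c‖) 1 • (y - c)
  have hΦ : ContinuousOn Φ (f '' B) := by
    have hne : ∀ y ∈ f '' B, ‖y - c‖ ≠ 0 := fun y hy h ↦
      hc (sub_eq_zero.1 (norm_eq_zero.1 h) ▸ hy)
    have hsub : ContinuousOn (fun y ↦ y - c) (f '' B) := by fun_prop
    have hdiv : ContinuousOn (fun y ↦ ε / ‖y - c‖) (f '' B) := continuousOn_const.div hsub.norm hne
    exact continuousOn_const.add ((hdiv.sup continuousOn_const).smul hsub)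
  have hΦout (y : E) (hy : y ∉ ball c ε) : Φ y = y := by
    have hy' : ε ≤ ‖y - c‖ := by simpa [dist_eq_norm] using hy
    simp [Φ, max_eq_right (div_le_one_of_le₀ hy' (norm_nonneg _))]
  have hΦin (y : E) (hyK : y ∈ f '' B) (hy : y ∈ ball c ε) : Φ y ∈ sphere c ε := by
    have hy' : ‖y - c‖ < ε := by simpa [dist_eq_norm] using hy
    have hpos : 0 < ‖y - c‖ := norm_pos_iff.2 (sub_ne_zero.2 fun h ↦ hc (h ▸ hyK))
    rw [mem_sphere_iff_norm, add_sub_cancel_left, max_eq_left ((one_le_div hpos).2 hy'.le),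
      norm_smul, Real.norm_of_nonneg (by positivity), div_mul_cancel₀ _ hpos.ne']
  obtain ⟨x, hx, hx0⟩ := exists_eq_zero_of_norm_sub_le_half
    (G := fun x ↦ P (Φ (f x)) - v)
    ((hP.continuous.comp_continuousOn (hΦ.comp hf (mapsTo_image f B))).sub continuousOn_const)
    fun x hx ↦ by
      have hQ := hQG (Φ (f x))
      have hδ'' : δ' ≤ 1 / 10 := min_le_right _ _
      by_cases hxc : f x ∈ ball c ε
      · have hcε' : dist c (f 0) < ε := hcε
        have hΦx : dist (Φ (f x)) c = ε := hΦin _ (mem_image_of_mem f hx) hxc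
        rw [mem_ball] at hxc
        have h1 : ‖x‖ < 1 / 10 := by
          rw [← hGf x hx]
          exact hGε _ (by linarith [dist_triangle (f x) c (f 0)])
        have h2 := hGε _ (show dist (Φ (f x)) (f 0) < 3 * ε by
          linarith [dist_triangle (Φ (f x)) c (f 0)])
        have h3 := norm_sub_le_norm_sub_add_norm_sub (P (Φ (f x)) - v) (G (Φ (f x))) x
        linarith [norm_sub_le (G (Φ (f x))) x]
      · rw [hΦout _ hxc, hGf x hx] at hQ
        rw [hΦout _ hxc]
        linarith
  by_cases hxc : f x ∈ ball c ε
  · exact hvP ⟨_, hΦin _ (mem_image_of_mem f hx) hxc, sub_eq_zero.1 hx0⟩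
  · rw [hΦout _ hxc] at hx0
    have h1 := hQG (f x)
    rw [hx0, zero_sub, norm_neg] at h1
    have h2 : δ' ≤ δ / 2 := min_le_left _ _
    linarith [hGδ _ ⟨mem_image_of_mem f hx, hxc⟩]

theorem isOpen_image_of_continuousOn_injOn {f : E → E} {V : Set E} (hV : IsOpen V)
    (hf : ContinuousOn f V) (hinj : InjOn f V) : IsOpen (f '' V) := by
  rw [isOpen_iff_mem_nhds]
  rintro _ ⟨a, ha, rfl⟩
  obtain ⟨ρ, hρ, hρV⟩ := nhds_basis_closedBall.mem_iff.1 (hV.mem_nhds ha)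
  let φ : E → E := fun x ↦ a + ρ • x
  have hφ : MapsTo φ (closedBall 0 1) V := fun x hx ↦ hρV <| by
    have : ‖x‖ ≤ 1 := by simpa using hx
    simpa [φ, norm_smul, abs_of_pos hρ] using mul_le_of_le_one_right hρ.le this
  have hφinj : InjOn φ (closedBall 0 1) := fun x _ y _ hxy ↦
    smul_right_injective E hρ.ne' (add_left_cancel hxy)
  have hφc : Continuous φ := by fun_prop
  have := image_closedBall_mem_nhds_of_injOn (f := f ∘ φ) (hf.comp hφc.continuousOn hφ)
    (hinj.comp hφinj hφ)
  rw [show (f ∘ φ) 0 = f a by simp [φ], image_comp] at this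
  exact mem_of_superset this (image_mono hφ.image_subset)

end

theorem invariance_of_domain (n : ℕ) (U : Set (Fin n → ℝ)) (hU : IsOpen U)
    (f : (Fin n → ℝ) → (Fin n → ℝ))
    (hf : ContinuousOn f U) (hinj : Set.InjOn f U) :
    IsOpen (f '' U) ∧ ∀ V : Set (Fin n → ℝ), V ⊆ U → IsOpen V → IsOpen (f '' V) := by
  have key (V : Set (Fin n → ℝ)) (hVU : V ⊆ U) (hV : IsOpen V) : IsOpen (f '' V) := by
    let e : EuclideanSpace ℝ (Fin n) ≃ₜ (Fin n → ℝ) :=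
      (EuclideanSpace.equiv (Fin n) ℝ).toHomeomorph
    have h := isOpen_image_of_continuousOn_injOn (f := e.symm ∘ f ∘ e) (V := e ⁻¹' V)
      (hV.preimage e.continuous)
      (e.symm.continuous.comp_continuousOn
        ((hf.mono hVU).comp e.continuous.continuousOn (mapsTo_preimage e V)))
      (e.symm.injective.comp_injOn
        ((hinj.mono hVU).comp e.injective.injOn (mapsTo_preimage e V)))
    rw [image_comp, image_comp, image_preimage_eq V e.surjective] at h
    exact e.symm.isOpen_image.1 h
  exact ⟨key U subset_rfl hU, key⟩
end

section
/- Grötzsch-type extremality for linear maps of rectangles (one-dimensional averaging form): let K ≥ 1 and let f : [0,1] × [0,1] → [0,K] × [0,1] be a continuously differentiable diffeomorphism mapping the left edge to the left edge and the right edge to the right edge (i.e. the first coordinate of f(0,y) is 0 and of f(1,y) is K), preserving orientation with positive Jacobian. Then the integral ∫∫ (|∂f/∂x|² + |∂f/∂y|²)/(2 Jac f) dx dy ≥ (K + 1/K)/2 · (area of the unit square) , with equality for the affine stretch f(x,y) = (Kx, y). (Equivalently: the maximal dilatation of any such map is at least K.) -/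
open MeasureTheory Set Filter Topology

/-- If `f` is injective on a compact set `s` with invertible derivative at `p ∈ s`, and `f '' s` is a
neighbourhood of `f p`, then no nonzero linear functional is extremal on `s` at `p`. -/
theorem IsExtrOn.eq_zero_of_image_mem_nhds {E : Type*} [NormedAddCommGroup E] [NormedSpace ℝ E]
    {f : E → E} {f' : E ≃L[ℝ] E} {s : Set E} {p : E} {l : E →L[ℝ] ℝ} (hl : IsExtrOn l s p)
    (hs : IsCompact s) (hc : ContinuousOn f s) (hinj : InjOn f s) (hp : p ∈ s)
    (hf : HasFDerivAt f (f' : E →L[ℝ] E) p) (hn : f '' s ∈ 𝓝 (f p)) : l = 0 := by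
  set g := Function.invFunOn f s with hg
  have hgp : g (f p) = p := hinj.leftInvOn_invFunOn hp
  have hcont : ContinuousOn g (f '' s) := by
    rw [continuousOn_iff_isClosed]
    intro t ht
    refine ⟨f '' (s ∩ t),
      ((hs.inter_right ht).image_of_continuousOn (hc.mono inter_subset_left)).isClosed, ?_⟩
    ext y
    constructor
    · rintro ⟨hy, x, hx, rfl⟩
      rw [mem_preimage, hg, hinj.leftInvOn_invFunOn hx] at hy
      exact ⟨⟨x, ⟨hx, hy⟩, rfl⟩, ⟨x, hx, rfl⟩⟩
    · rintro ⟨⟨x, ⟨hx, hxt⟩, rfl⟩, -⟩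
      refine ⟨?_, ⟨x, hx, rfl⟩⟩
      rwa [mem_preimage, hg, hinj.leftInvOn_invFunOn hx]
  have hderiv : HasFDerivAt g (f'.symm : E →L[ℝ] E) (f p) := by
    refine HasFDerivAt.of_local_left_inverse (hcont.continuousAt hn) (hgp.symm ▸ hf) ?_
    filter_upwards [hn] with y hy using Function.invFunOn_eq hy
  have hmem : ∀ᶠ y in 𝓝 (f p), g y ∈ s := by
    filter_upwards [hn] with y hy using Function.invFunOn_mem hy
  have hext : IsLocalExtr (l ∘ g) (f p) := by
    refine hl.imp (fun h => ?_) (fun h => ?_)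
    · filter_upwards [hmem] with y hy
      simpa [hgp] using h hy
    · filter_upwards [hmem] with y hy
      simpa [hgp] using h hy
  have hzero := hext.hasFDerivAt_eq_zero (l.hasFDerivAt.comp (f p) hderiv)
  ext v
  simpa using congrArg (fun m : E →L[ℝ] ℝ => m (f' v)) hzero

/-- A `C¹` homeomorphism between rectangles that preserves the vertical sides maps each horizontal
side into a horizontal side. -/
theorem exists_snd_eq_on_horizontal_side {K : ℝ} (hK : 0 < K) {f : ℝ × ℝ → ℝ × ℝ} {c : ℝ}
    (hc : c = 0 ∨ c = 1)
    (hcont : ContinuousOn f (Icc ((0 : ℝ), (0 : ℝ)) ((1 : ℝ), (1 : ℝ))))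
    (hinj : InjOn f (Icc ((0 : ℝ), (0 : ℝ)) ((1 : ℝ), (1 : ℝ))))
    (himg : f '' Icc ((0 : ℝ), (0 : ℝ)) ((1 : ℝ), (1 : ℝ)) = Icc ((0 : ℝ), (0 : ℝ)) (K, (1 : ℝ)))
    (hleft : (f (0, c)).1 = 0) (hright : (f (1, c)).1 = K)
    (hdiff : ∀ p ∈ Icc ((0 : ℝ), (0 : ℝ)) ((1 : ℝ), (1 : ℝ)), DifferentiableAt ℝ f p)
    (hdet : ∀ p ∈ Icc ((0 : ℝ), (0 : ℝ)) ((1 : ℝ), (1 : ℝ)), (fderiv ℝ f p).det ≠ 0) :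
    ∃ d : ℝ, (d = 0 ∨ d = 1) ∧ ∀ x ∈ Icc (0 : ℝ) 1, (f (x, c)).2 = d := by
  have hc01 : 0 ≤ c ∧ c ≤ 1 := by rcases hc with rfl | rfl <;> norm_num
  have hmem : ∀ x ∈ Icc (0 : ℝ) 1, (x, c) ∈ Icc ((0 : ℝ), (0 : ℝ)) ((1 : ℝ), (1 : ℝ)) :=
    fun x hx => ⟨⟨hx.1, hc01.1⟩, ⟨hx.2, hc01.2⟩⟩
  have hR : ∀ x ∈ Icc (0 : ℝ) 1, (0 ≤ (f (x, c)).1 ∧ 0 ≤ (f (x, c)).2) ∧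
      ((f (x, c)).1 ≤ K ∧ (f (x, c)).2 ≤ 1) := fun x hx => by
    have h := mem_image_of_mem f (hmem x hx)
    rw [himg] at h
    exact h
  have hcc : ContinuousOn (fun x : ℝ => f (x, c)) (Icc 0 1) :=
    hcont.comp (by fun_prop) hmem
  have hc1 : ContinuousOn (fun x : ℝ => (f (x, c)).1) (Icc 0 1) :=
    continuous_fst.comp_continuousOn hcc
  have hc2 : ContinuousOn (fun x : ℝ => (f (x, c)).2) (Icc 0 1) :=
    continuous_snd.comp_continuousOn hcc
  have hclosed : ∀ (h : ℝ → ℝ) (_ : ContinuousOn h (Icc 0 1)) (t : Set ℝ), IsClosed t →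
      IsClosed (Icc (0 : ℝ) 1 ∩ h ⁻¹' t) := fun h hh t ht => hh.preimage_isClosed_of_isClosed
        isClosed_Icc ht
  have hpair : ∀ a b : ℝ, IsClosed ({a, b} : Set ℝ) := fun a b => (toFinite _).isClosed
  set u := Icc (0 : ℝ) 1 ∩ (fun x : ℝ => (f (x, c)).1) ⁻¹' {0, K} with hu
  set v := Icc (0 : ℝ) 1 ∩ (fun x : ℝ => (f (x, c)).2) ⁻¹' {0, 1} with hv
  have huc : IsClosed u := hclosed _ hc1 _ (hpair _ _)
  have hvc : IsClosed v := hclosed _ hc2 _ (hpair _ _)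
  have hcover : Ioo (0 : ℝ) 1 ⊆ u ∪ v := by
    intro x hx
    have hx' := Ioo_subset_Icc_self hx
    by_contra hcon
    obtain ⟨⟨h1, h2⟩, h3, h4⟩ := hR x hx'
    have hnu : (f (x, c)).1 ≠ 0 ∧ (f (x, c)).1 ≠ K :=
      ⟨fun h => hcon (Or.inl ⟨hx', Or.inl h⟩), fun h => hcon (Or.inl ⟨hx', Or.inr h⟩)⟩
    have hnv : (f (x, c)).2 ≠ 0 ∧ (f (x, c)).2 ≠ 1 :=
      ⟨fun h => hcon (Or.inr ⟨hx', Or.inl h⟩), fun h => hcon (Or.inr ⟨hx', Or.inr h⟩)⟩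
    have hn : f '' Icc ((0 : ℝ), (0 : ℝ)) ((1 : ℝ), (1 : ℝ)) ∈ 𝓝 (f (x, c)) := by
      rw [himg, Icc_prod_eq]
      exact prod_mem_nhds (Icc_mem_nhds (h1.lt_of_ne' hnu.1) (h3.lt_of_ne hnu.2))
        (Icc_mem_nhds (h2.lt_of_ne' hnv.1) (h4.lt_of_ne hnv.2))
    have hext : IsExtrOn (ContinuousLinearMap.snd ℝ ℝ ℝ) (Icc ((0 : ℝ), (0 : ℝ)) ((1 : ℝ), (1 : ℝ)))
        (x, c) := by
      rcases hc with rfl | rfl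
      · exact Or.inl fun q hq => hq.1.2
      · exact Or.inr fun q hq => hq.2.2
    have hzero := hext.eq_zero_of_image_mem_nhds
      (f' := (fderiv ℝ f (x, c)).toContinuousLinearEquivOfDetNeZero (hdet _ (hmem x hx')))
      isCompact_Icc hcont hinj (hmem x hx') (by simpa using (hdiff _ (hmem x hx')).hasFDerivAt) hn
    simpa using congrArg (fun m : ℝ × ℝ →L[ℝ] ℝ => m (0, 1)) hzero
  have hdisj : Ioo (0 : ℝ) 1 ∩ (u ∩ v) = ∅ := by
    rw [eq_empty_iff_forall_notMem]
    rintro x ⟨hx, ⟨hx', h1⟩, -, h2⟩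
    have hI : Icc (0 : ℝ) 1 ∈ 𝓝 x := Icc_mem_nhds hx.1 hx.2
    have hd : HasDerivAt (fun t : ℝ => f (t, c)) (fderiv ℝ f (x, c) (1, 0)) x :=
      HasFDerivAt.comp_hasDerivAt x (hdiff _ (hmem x hx')).hasFDerivAt
        ((hasDerivAt_id x).prodMk (hasDerivAt_const x c))
    have e1 : IsLocalExtr (fun t : ℝ => (f (t, c)).1) x := by
      rcases h1 with h1 | h1
      · left; filter_upwards [hI] with t ht
        rw [show (f (x, c)).1 = 0 from h1]; exact (hR t ht).1.1
      · right; filter_upwards [hI] with t ht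
        rw [show (f (x, c)).1 = K from h1]; exact (hR t ht).2.1
    have e2 : IsLocalExtr (fun t : ℝ => (f (t, c)).2) x := by
      rcases h2 with h2 | h2
      · left; filter_upwards [hI] with t ht
        rw [show (f (x, c)).2 = 0 from h2]; exact (hR t ht).1.2
      · right; filter_upwards [hI] with t ht
        rw [show (f (x, c)).2 = 1 from h2]; exact (hR t ht).2.2
    have z1 := e1.hasDerivAt_eq_zero hd.fst
    have z2 := e2.hasDerivAt_eq_zero hd.snd
    have z : fderiv ℝ f (x, c) (1, 0) = 0 := Prod.ext z1 z2
    have := ((fderiv ℝ f (x, c)).toContinuousLinearEquivOfDetNeZero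
      (hdet _ (hmem x hx'))).injective (a₁ := (1, 0)) (a₂ := 0) (by simpa using z)
    simp at this
  have hclos : ∀ w : Set ℝ, IsClosed w → Ioo (0 : ℝ) 1 ⊆ w → Icc (0 : ℝ) 1 ⊆ w := fun w hw h => by
    rw [← closure_Ioo (zero_ne_one' ℝ)]
    exact closure_minimal h hw
  rcases isPreconnected_iff_subset_of_disjoint_closed.1 isPreconnected_Ioo u v huc hvc hcover hdisj
    with h | h
  · exfalso
    have hK2 : K / 2 ∈ Icc (f (0, c)).1 (f (1, c)).1 := by
      rw [hleft, hright]; constructor <;> linarith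
    obtain ⟨x, hx, hxK⟩ := intermediate_value_Icc zero_le_one hc1 hK2
    have hxu : (f (x, c)).1 = 0 ∨ (f (x, c)).1 = K := (hclos u huc h hx).2
    have hxK' : (f (x, c)).1 = K / 2 := hxK
    rcases hxu with hxu | hxu <;> linarith
  · have hsub := hclos v hvc h
    rcases isPreconnected_iff_subset_of_disjoint_closed.1 isPreconnected_Icc
      (Icc (0 : ℝ) 1 ∩ (fun x : ℝ => (f (x, c)).2) ⁻¹' {0})
      (Icc (0 : ℝ) 1 ∩ (fun x : ℝ => (f (x, c)).2) ⁻¹' {1})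
      (hclosed _ hc2 _ isClosed_singleton) (hclosed _ hc2 _ isClosed_singleton)
      (fun x hx => (hsub hx).2.imp (fun h => ⟨hx, h⟩) (fun h => ⟨hx, h⟩))
      (by
        rw [eq_empty_iff_forall_notMem]
        rintro x ⟨-, ⟨-, h1⟩, -, h2⟩
        exact zero_ne_one ((show (f (x, c)).2 = 0 from h1).symm.trans h2)) with h0 | h0
    · exact ⟨0, Or.inl rfl, fun x hx => (h0 hx).2⟩
    · exact ⟨1, Or.inr rfl, fun x hx => (h0 hx).2⟩

/-- Tangent-line lower bound for the dilatation quotient in the sup norm. -/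
theorem add_sub_le_dilatation {K s J : ℝ} (hs : s ^ 2 = 1) (hJ : 0 < J)
    (v w : ℝ × ℝ) :
    (v.1 + s / K * w.2) - (1 + (K⁻¹) ^ 2) / 2 * J ≤ (‖v‖ ^ 2 + ‖w‖ ^ 2) / (2 * J) := by
  have hv : v.1 ^ 2 ≤ ‖v‖ ^ 2 := by
    rw [← sq_abs v.1]
    exact pow_le_pow_left₀ (abs_nonneg _) (norm_fst_le v) 2
  have hw : w.2 ^ 2 ≤ ‖w‖ ^ 2 := by
    rw [← sq_abs w.2]
    exact pow_le_pow_left₀ (abs_nonneg _) (norm_snd_le w) 2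
  rw [le_div_iff₀ (by positivity), div_eq_mul_inv]
  have h : (s * K⁻¹ * J) ^ 2 = (K⁻¹ * J) ^ 2 := by
    linear_combination (K⁻¹ * J) ^ 2 * hs
  nlinarith [sq_nonneg (v.1 - J), sq_nonneg (w.2 - s * K⁻¹ * J)]

theorem groetzsch_extremal_inequality (K : ℝ) (hK : 1 ≤ K)
    (f : ℝ × ℝ → ℝ × ℝ)
    (Q : Set (ℝ × ℝ)) (hQ : Q = Set.Icc ((0 : ℝ), (0 : ℝ)) ((1 : ℝ), (1 : ℝ)))
    (hreg : ContDiffOn ℝ 1 f Q)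
    (hinj : Set.InjOn f Q)
    (himg : f '' Q = Set.Icc ((0 : ℝ), (0 : ℝ)) (K, (1 : ℝ)))
    (hleft : ∀ y ∈ Set.Icc (0 : ℝ) 1, (f (0, y)).1 = 0)
    (hright : ∀ y ∈ Set.Icc (0 : ℝ) 1, (f (1, y)).1 = K)
    (hjac : ∀ p ∈ Q, 0 < (fderiv ℝ f p).det) :
    (K + K⁻¹) / 2 ≤
      ∫ p in Q, (‖fderiv ℝ f p (1, 0)‖ ^ 2 + ‖fderiv ℝ f p (0, 1)‖ ^ 2) /
        (2 * (fderiv ℝ f p).det) := by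
  subst hQ
  set Q : Set (ℝ × ℝ) := Icc ((0 : ℝ), (0 : ℝ)) ((1 : ℝ), (1 : ℝ)) with hQ
  have hK0 : 0 < K := by linarith
  have hcont : ContinuousOn f Q := hreg.continuousOn
  have hQc : IsCompact Q := isCompact_Icc
  have hdiff : ∀ p ∈ Q, DifferentiableAt ℝ f p := fun p hp => by
    by_contra h
    have := hjac p hp
    rw [fderiv_zero_of_not_differentiableAt h] at this
    simp [ContinuousLinearMap.det] at this
  have huniq : UniqueDiffOn ℝ Q := by
    rw [hQ, Icc_prod_eq]
    exact (uniqueDiffOn_Icc zero_lt_one).prod (uniqueDiffOn_Icc zero_lt_one)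
  have hD : ContinuousOn (fderiv ℝ f) Q :=
    (hreg.continuousOn_fderivWithin huniq le_rfl).congr fun p hp =>
      (fderivWithin_eq_fderiv (huniq p hp) (hdiff p hp)).symm
  have hJ : ContinuousOn (fun p => (fderiv ℝ f p).det) Q :=
    ContinuousLinearMap.continuous_det.comp_continuousOn hD
  have hDv : ∀ v, ContinuousOn (fun p => fderiv ℝ f p v) Q := fun v => hD.clm_apply continuousOn_const
  obtain ⟨d₀, hd₀, hbot⟩ := exists_snd_eq_on_horizontal_side hK0 (Or.inl rfl) hcont hinj himg
    (hleft 0 (by simp)) (hright 0 (by simp)) hdiff fun p hp => (hjac p hp).ne'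
  obtain ⟨d₁, hd₁, htop⟩ := exists_snd_eq_on_horizontal_side hK0 (Or.inr rfl) hcont hinj himg
    (hleft 1 (by simp)) (hright 1 (by simp)) hdiff fun p hp => (hjac p hp).ne'
  have hne : d₀ ≠ d₁ := fun h => by
    have : ((0 : ℝ), (0 : ℝ)) = (0, 1) := by
      refine hinj ⟨⟨by simp, by simp⟩, ⟨by simp, by simp⟩⟩ ⟨⟨by simp, by simp⟩, ⟨by simp, by simp⟩⟩
        (Prod.ext ?_ ?_)
      · rw [hleft 0 (by simp), hleft 1 (by simp)]
      · rw [hbot 0 (by simp), htop 0 (by simp), h]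
    simp at this
  set s := d₁ - d₀ with hs
  have hs2 : s ^ 2 = 1 := by
    rcases hd₀ with rfl | rfl <;> rcases hd₁ with rfl | rfl <;> simp_all
  have harea : ∫ p in Q, (fderiv ℝ f p).det = K := by
    have h := integral_image_eq_integral_abs_det_fderiv_smul volume measurableSet_Icc
      (fun p hp => (hdiff p hp).hasFDerivAt.hasFDerivWithinAt) hinj (fun _ => (1 : ℝ))
    rw [himg] at h
    have h' : ∫ p in Q, |(fderiv ℝ f p).det| • (1 : ℝ) = ∫ p in Q, (fderiv ℝ f p).det :=
      setIntegral_congr_fun measurableSet_Icc fun p hp => by simp [abs_of_pos (hjac p hp)]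
    rw [← h', ← h, setIntegral_const, Icc_prod_eq, Measure.volume_eq_prod, measureReal_prod_prod]
    simp [hK0.le]
  have hcdiv : ContinuousOn
      (fun p => (fderiv ℝ f p (1, 0)).1 + s / K * (fderiv ℝ f p (0, 1)).2) Q :=
    (continuous_fst.comp_continuousOn (hDv _)).add
      (continuousOn_const.mul (continuous_snd.comp_continuousOn (hDv _)))
  have hdiv : ∫ p in Q, ((fderiv ℝ f p (1, 0)).1 + s / K * (fderiv ℝ f p (0, 1)).2) =
      K + K⁻¹ := by
    have hsub : Ioo (0 : ℝ) 1 ×ˢ Ioo (0 : ℝ) 1 ⊆ Q := by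
      rw [hQ, Icc_prod_eq]
      exact prod_mono Ioo_subset_Icc_self Ioo_subset_Icc_self
    have h := integral_divergence_prod_Icc_of_hasFDerivAt_of_le
      (fun p => (f p).1) (fun p => s / K * (f p).2)
      (fun p => (ContinuousLinearMap.fst ℝ ℝ ℝ).comp (fderiv ℝ f p))
      (fun p => (s / K) • (ContinuousLinearMap.snd ℝ ℝ ℝ).comp (fderiv ℝ f p))
      (0, 0) (1, 1) ⟨by simp, by simp⟩ (continuous_fst.comp_continuousOn hcont)
      (continuousOn_const.mul (continuous_snd.comp_continuousOn hcont))
      (fun p hp => (hdiff p (hsub hp)).hasFDerivAt.fst)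
      (fun p hp => (hdiff p (hsub hp)).hasFDerivAt.snd.const_mul (s / K))
      (by simpa using hcdiv.integrableOn_compact hQc)
    have hT : ∫ x in (0 : ℝ)..1, s / K * (f (x, 1)).2 = s / K * d₁ := by
      rw [intervalIntegral.integral_congr (g := fun _ => s / K * d₁)
        fun x hx => by simp only [htop x (by simpa using hx)]]
      simp
    have hB : ∫ x in (0 : ℝ)..1, s / K * (f (x, 0)).2 = s / K * d₀ := by
      rw [intervalIntegral.integral_congr (g := fun _ => s / K * d₀)
        fun x hx => by simp only [hbot x (by simpa using hx)]]
      simp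
    have hL : ∫ y in (0 : ℝ)..1, (f (0, y)).1 = 0 := by
      rw [intervalIntegral.integral_congr (g := fun _ => (0 : ℝ))
        fun y hy => hleft y (by simpa using hy)]
      simp
    have hRt : ∫ y in (0 : ℝ)..1, (f (1, y)).1 = K := by
      rw [intervalIntegral.integral_congr (g := fun _ => K)
        fun y hy => hright y (by simpa using hy)]
      simp
    have h' : ∫ p in Q, ((fderiv ℝ f p (1, 0)).1 + s / K * (fderiv ℝ f p (0, 1)).2) = _ := h
    rw [h', hT, hB, hL, hRt, div_eq_mul_inv]
    linear_combination K⁻¹ * hs2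
  have hint1 := hcdiv.integrableOn_compact (μ := volume) hQc
  have hint2 : IntegrableOn (fun p => (1 + (K⁻¹) ^ 2) / 2 * (fderiv ℝ f p).det) Q :=
    (continuousOn_const.mul hJ).integrableOn_compact hQc
  have hint3 : IntegrableOn (fun p => (‖fderiv ℝ f p (1, 0)‖ ^ 2 + ‖fderiv ℝ f p (0, 1)‖ ^ 2) /
        (2 * (fderiv ℝ f p).det)) Q :=
    ((((hDv _).norm.pow 2).add ((hDv _).norm.pow 2)).div (continuousOn_const.mul hJ)
      fun p hp => (mul_pos two_pos (hjac p hp)).ne').integrableOn_compact hQc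
  calc (K + K⁻¹) / 2 = (K + K⁻¹) - (1 + (K⁻¹) ^ 2) / 2 * K := by field_simp; ring
    _ = ∫ p in Q, (((fderiv ℝ f p (1, 0)).1 + s / K * (fderiv ℝ f p (0, 1)).2) -
          (1 + (K⁻¹) ^ 2) / 2 * (fderiv ℝ f p).det) := by
      rw [integral_sub hint1 hint2, integral_const_mul, harea, hdiv]
    _ ≤ _ := setIntegral_mono_on (hint1.sub hint2) hint3 measurableSet_Icc fun p hp =>
      add_sub_le_dilatation hs2 (hjac p hp) _ _
end
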